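/- arXiv:2508.01993 — 4 statements merged into one kernel-verified Lean document; each statement's English description precedes it below -/
import Mathlib

section
/- For all weights x, y > 0, the weighted connective constant of self-avoiding walks on the square lattice satisfies μ(x,y) ≤ 2^{−1/2}·[x² + 8xy + y² + (x + y)·√(x² + 14xy + y²)]^{1/2}. -/
open scoped BigOperators

def sqStep : Fin 4 → ℤ × ℤ
  | 0 => (1, 0)
  | 1 => (-1, 0)
  | 2 => (0, 1)
  | 3 => (0, -1)

/-- Position of the walk after `i` steps, starting at the origin. -/
def sqPos {n : ℕ} (ω : Fin n → Fin 4) (i : Fin (n + 1)) : ℤ × ℤ :=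
  ∑ j : Fin n, if (j : ℕ) < (i : ℕ) then sqStep (ω j) else 0

/-- A walk is self-avoiding if its vertices are pairwise distinct. -/
def sqIsSAW {n : ℕ} (ω : Fin n → Fin 4) : Prop :=
  Function.Injective (sqPos ω)

/-- Number of horizontal steps. -/
def sqNh {n : ℕ} (ω : Fin n → Fin 4) : ℕ :=
  (Finset.univ.filter fun j => ω j = 0 ∨ ω j = 1).card

/-- Number of vertical steps. -/
def sqNv {n : ℕ} (ω : Fin n → Fin 4) : ℕ :=
  (Finset.univ.filter fun j => ω j = 2 ∨ ω j = 3).card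

/-- Weight `x^{N_h} y^{N_v}` of a walk. -/
noncomputable def sqWeight (x y : ℝ) {n : ℕ} (ω : Fin n → Fin 4) : ℝ :=
  x ^ sqNh ω * y ^ sqNv ω

/- `sawCount n x y` is `c_n(x,y)`: the sum of the weights of all `n`-step
self-avoiding walks starting at the origin. -/
open Classical in
noncomputable def sawCount (n : ℕ) (x y : ℝ) : ℝ :=
  ∑ ω ∈ Finset.univ.filter (fun ω : Fin n → Fin 4 => sqIsSAW ω), sqWeight x y ω

/-- The weighted connective constant `μ(x,y) = inf_{n ≥ 1} c_n(x,y)^{1/n}`. -/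
noncomputable def sawMu (x y : ℝ) : ℝ :=
  ⨅ n : ℕ, sawCount (n + 1) x y ^ (1 / (n + 1 : ℝ))

/-- Weight of a single step: `x` if horizontal, `y` if vertical. -/
noncomputable def sqStepWeight (x y : ℝ) (a : Fin 4) : ℝ :=
  if a = 0 ∨ a = 1 then x else y

theorem sqWeight_eq_prod (x y : ℝ) {n : ℕ} (ω : Fin n → Fin 4) :
    sqWeight x y ω = ∏ j, sqStepWeight x y (ω j) := by
  have h : ∀ a : Fin 4, sqStepWeight x y a =
      (if a = 0 ∨ a = 1 then x else 1) * (if a = 2 ∨ a = 3 then y else 1) := by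
    intro a
    fin_cases a <;> simp [sqStepWeight]
  simp only [h, Finset.prod_mul_distrib, sqWeight, sqNh, sqNv, Finset.prod_ite,
    Finset.prod_const, one_pow, mul_one]

theorem sqWeight_cons (x y : ℝ) {n : ℕ} (a : Fin 4) (ω : Fin n → Fin 4) :
    sqWeight x y (Fin.cons a ω : Fin (n + 1) → Fin 4) =
      sqStepWeight x y a * sqWeight x y ω := by
  simp [sqWeight_eq_prod, Fin.prod_univ_succ]

theorem sqWeight_nonneg {x y : ℝ} (hx : 0 < x) (hy : 0 < y) {n : ℕ} (ω : Fin n → Fin 4) :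
    0 ≤ sqWeight x y ω := by
  unfold sqWeight
  positivity

theorem sqPos_zero {n : ℕ} (ω : Fin n → Fin 4) : sqPos ω 0 = 0 := by
  simp [sqPos]

theorem sqPos_cons_succ {n : ℕ} (a : Fin 4) (ω : Fin n → Fin 4) (i : Fin (n + 1)) :
    sqPos (Fin.cons a ω : Fin (n + 1) → Fin 4) i.succ = sqStep a + sqPos ω i := by
  simp only [sqPos, Fin.sum_univ_succ, Fin.cons_zero, Fin.cons_succ, Fin.val_succ, Fin.val_zero,
    Nat.succ_pos, if_true, Nat.add_lt_add_iff_right]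

theorem sqPos_succ_zero {n : ℕ} (ω : Fin (n + 1) → Fin 4) :
    sqPos ω (Fin.succ 0) = sqStep (ω 0) := by
  simp [sqPos]

theorem sqIsSAW_of_cons {n : ℕ} {a : Fin 4} {ω : Fin n → Fin 4}
    (h : sqIsSAW (Fin.cons a ω : Fin (n + 1) → Fin 4)) : sqIsSAW ω := by
  intro i j hij
  apply Fin.succ_injective
  apply h
  rw [sqPos_cons_succ, sqPos_cons_succ, hij]

theorem sqStep_add_ne_zero_of_cons {n : ℕ} {a : Fin 4} {ω : Fin (n + 1) → Fin 4}
    (h : sqIsSAW (Fin.cons a ω : Fin (n + 2) → Fin 4)) :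
    sqStep a + sqStep (ω 0) ≠ 0 := by
  intro h0
  have h1 : sqPos (Fin.cons a ω : Fin (n + 2) → Fin 4) (Fin.succ (Fin.succ 0)) =
      sqPos (Fin.cons a ω : Fin (n + 2) → Fin 4) 0 := by
    rw [sqPos_cons_succ, sqPos_succ_zero, sqPos_zero, h0]
  exact Fin.succ_ne_zero _ (h h1)

/-- The Perron eigenvalue of the non-backtracking step matrix `!![x, 2 * y; 2 * x, y]`. -/
noncomputable def nbEigenvalue (x y : ℝ) : ℝ :=
  (x + y + Real.sqrt (x ^ 2 + 14 * x * y + y ^ 2)) / 2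

theorem nbEigenvalue_sq {x y : ℝ} (hx : 0 < x) (hy : 0 < y) :
    nbEigenvalue x y ^ 2 = (x + y) * nbEigenvalue x y + 3 * x * y := by
  have h : Real.sqrt (x ^ 2 + 14 * x * y + y ^ 2) ^ 2 = x ^ 2 + 14 * x * y + y ^ 2 :=
    Real.sq_sqrt (by positivity)
  unfold nbEigenvalue
  linear_combination h / 4

theorem nbEigenvalue_pos {x y : ℝ} (hx : 0 < x) (hy : 0 < y) : 0 < nbEigenvalue x y := by
  unfold nbEigenvalue
  positivity

theorem lt_nbEigenvalue {x y : ℝ} (hx : 0 < x) (hy : 0 < y) : x < nbEigenvalue x y := by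
  have h := nbEigenvalue_sq hx hy
  have h0 := nbEigenvalue_pos hx hy
  by_contra! hle
  nlinarith [mul_pos hx hy, mul_pos h0 hy, mul_nonneg h0.le (sub_nonneg.2 hle)]

/-- The Perron eigenvector of the non-backtracking step matrix. -/
noncomputable def nbEigenvector (x y : ℝ) (a : Fin 4) : ℝ :=
  if a = 0 ∨ a = 1 then 2 * y else nbEigenvalue x y - x

theorem nbEigenvector_pos {x y : ℝ} (hx : 0 < x) (hy : 0 < y) (a : Fin 4) :
    0 < nbEigenvector x y a := by
  have := lt_nbEigenvalue hx hy
  unfold nbEigenvector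
  split_ifs <;> linarith

theorem sum_nbEigenvector {x y : ℝ} (hx : 0 < x) (hy : 0 < y) (b : Fin 4) :
    (∑ a, if sqStep a + sqStep b ≠ 0 then sqStepWeight x y a * nbEigenvector x y a else 0) =
      nbEigenvalue x y * nbEigenvector x y b := by
  have h := nbEigenvalue_sq hx hy
  fin_cases b <;>
    simp [Fin.sum_univ_four, sqStep, sqStepWeight, nbEigenvector] <;> linarith

open Classical in
/-- Self-avoiding walks of `n + 1` steps, weighted also by the eigenvector at the first step. -/
noncomputable def eigenSawCount (n : ℕ) (x y : ℝ) : ℝ :=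
  ∑ ω : Fin (n + 1) → Fin 4,
    if sqIsSAW ω then sqWeight x y ω * nbEigenvector x y (ω 0) else 0

theorem eigenSawCount_succ_le {x y : ℝ} (hx : 0 < x) (hy : 0 < y) (n : ℕ) :
    eigenSawCount (n + 1) x y ≤ nbEigenvalue x y * eigenSawCount n x y := by
  classical
  unfold eigenSawCount
  rw [← (Fin.consEquiv fun _ : Fin (n + 2) => Fin 4).sum_comp, Fintype.sum_prod_type_right,
    Finset.mul_sum]
  refine Finset.sum_le_sum fun ω _ => ?_
  by_cases hω : sqIsSAW ω
  · have hw := sqWeight_nonneg hx hy ω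
    have hs : ∀ a, 0 ≤ sqStepWeight x y a := by
      intro a
      unfold sqStepWeight
      split_ifs <;> linarith
    rw [if_pos hω, mul_left_comm, ← sum_nbEigenvector hx hy, Finset.mul_sum]
    refine Finset.sum_le_sum fun a _ => ?_
    change (if sqIsSAW (Fin.cons a ω : Fin (n + 2) → Fin 4) then
      sqWeight x y (Fin.cons a ω : Fin (n + 2) → Fin 4) * nbEigenvector x y a else 0) ≤ _
    by_cases hc : sqIsSAW (Fin.cons a ω : Fin (n + 2) → Fin 4)
    · rw [if_pos hc, if_pos (sqStep_add_ne_zero_of_cons hc), sqWeight_cons]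
      exact le_of_eq (by ring)
    · rw [if_neg hc]
      have := nbEigenvector_pos hx hy a
      have := hs a
      split_ifs <;> positivity
  · rw [if_neg hω, mul_zero]
    refine (Finset.sum_eq_zero fun a _ => if_neg ?_).le
    exact fun h => hω (sqIsSAW_of_cons h)

theorem sawCount_nonneg {x y : ℝ} (hx : 0 < x) (hy : 0 < y) (n : ℕ) : 0 ≤ sawCount n x y :=
  Finset.sum_nonneg fun ω _ => sqWeight_nonneg hx hy ω

theorem exists_sawCount_le {x y : ℝ} (hx : 0 < x) (hy : 0 < y) :
    ∃ C : ℝ, 0 < C ∧ ∀ n, sawCount (n + 1) x y ≤ C * nbEigenvalue x y ^ (n + 1) := by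
  classical
  have hl := nbEigenvalue_pos hx hy
  have hbound : ∀ n, eigenSawCount n x y ≤ nbEigenvalue x y ^ n * eigenSawCount 0 x y := by
    intro n
    induction n with
    | zero => simp
    | succ n ih =>
      refine (eigenSawCount_succ_le hx hy n).trans ?_
      rw [pow_succ', mul_assoc]
      gcongr
  obtain ⟨a₀, -, ha₀⟩ := Finset.exists_min_image Finset.univ (nbEigenvector x y)
    ⟨0, Finset.mem_univ _⟩
  have hm := nbEigenvector_pos hx hy a₀
  have hcount : ∀ n, sawCount (n + 1) x y * nbEigenvector x y a₀ ≤ eigenSawCount n x y := by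
    intro n
    unfold sawCount eigenSawCount
    rw [Finset.sum_filter, Finset.sum_mul]
    refine Finset.sum_le_sum fun ω _ => ?_
    split_ifs
    · exact mul_le_mul_of_nonneg_left (ha₀ _ (Finset.mem_univ _)) (sqWeight_nonneg hx hy ω)
    · simp
  have h0 : 0 ≤ eigenSawCount 0 x y :=
    (mul_nonneg (sawCount_nonneg hx hy _) hm.le).trans (hcount 0)
  refine ⟨(eigenSawCount 0 x y + 1) / (nbEigenvector x y a₀ * nbEigenvalue x y),
    by positivity, fun n => ?_⟩
  have h : (eigenSawCount 0 x y + 1) / (nbEigenvector x y a₀ * nbEigenvalue x y) *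
      nbEigenvalue x y ^ (n + 1) =
      nbEigenvalue x y ^ n * (eigenSawCount 0 x y + 1) / nbEigenvector x y a₀ := by
    field_simp
    ring
  rw [h, le_div_iff₀ hm]
  refine (hcount n).trans ((hbound n).trans ?_)
  gcongr
  linarith

theorem sawMu_le_nbEigenvalue {x y : ℝ} (hx : 0 < x) (hy : 0 < y) :
    sawMu x y ≤ nbEigenvalue x y := by
  have hl := nbEigenvalue_pos hx hy
  obtain ⟨C, hC, hle⟩ := exists_sawCount_le hx hy
  have hbdd : BddBelow (Set.range fun n : ℕ => sawCount (n + 1) x y ^ (1 / (n + 1 : ℝ))) := by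
    refine ⟨0, ?_⟩
    rintro _ ⟨n, rfl⟩
    exact Real.rpow_nonneg (sawCount_nonneg hx hy _) _
  have hmu : ∀ n : ℕ, sawMu x y ≤ C ^ (1 / (n + 1 : ℝ)) * nbEigenvalue x y := by
    intro n
    refine (ciInf_le hbdd n).trans ?_
    refine (Real.rpow_le_rpow (sawCount_nonneg hx hy _) (hle n) (by positivity)).trans ?_
    rw [Real.mul_rpow hC.le (by positivity), one_div]
    have := Real.pow_rpow_inv_natCast hl.le (Nat.succ_ne_zero n)
    push_cast at this
    rw [this]
  have hlim : Filter.Tendsto (fun n : ℕ => C ^ (1 / (n + 1 : ℝ)) * nbEigenvalue x y)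
      Filter.atTop (nhds (nbEigenvalue x y)) := by
    have := (Real.continuousAt_const_rpow hC.ne').tendsto.comp
      (tendsto_one_div_add_atTop_nhds_zero_nat (𝕜 := ℝ))
    rw [Real.rpow_zero] at this
    simpa [Function.comp_def] using this.mul_const (nbEigenvalue x y)
  exact ge_of_tendsto' hlim hmu

theorem sawMu_le_bound_m1_n3 (x y : ℝ) (hx : 0 < x) (hy : 0 < y) :
    sawMu x y ≤ (2 : ℝ) ^ (-(1 / 2 : ℝ)) *
      (x ^ 2 + 8 * x * y + y ^ 2 +
        (x + y) * Real.sqrt (x ^ 2 + 14 * x * y + y ^ 2)) ^ (1 / 2 : ℝ) := by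
  have hl := nbEigenvalue_pos hx hy
  have h : x ^ 2 + 8 * x * y + y ^ 2 +
      (x + y) * Real.sqrt (x ^ 2 + 14 * x * y + y ^ 2) = 2 * nbEigenvalue x y ^ 2 := by
    rw [nbEigenvalue_sq hx hy, nbEigenvalue]
    ring
  rw [h, Real.mul_rpow (by norm_num) (by positivity), ← mul_assoc, ← Real.rpow_add (by norm_num),
    neg_add_cancel, Real.rpow_zero, one_mul, ← Real.sqrt_eq_rpow, Real.sqrt_sq hl.le]
  exact sawMu_le_nbEigenvalue hx hy
end

section
/- For all weights x, z > 0, the weighted connective constant of self-avoiding walks on the simple cubic lattice, with steps in the ±e₁ and ±e₂ directions weighted x and steps in the ±e₃ direction weighted z, satisfies μ₃(x,z) ≤ (1/2)·(3x + z + √(9x² + 26xz + z²)). -/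
open scoped BigOperators

def cubeStep : Fin 6 → ℤ × ℤ × ℤ
  | 0 => (1, 0, 0)
  | 1 => (-1, 0, 0)
  | 2 => (0, 1, 0)
  | 3 => (0, -1, 0)
  | 4 => (0, 0, 1)
  | 5 => (0, 0, -1)

/-- Position of the walk after `i` steps, starting at the origin. -/
def cubePos {n : ℕ} (ω : Fin n → Fin 6) (i : Fin (n + 1)) : ℤ × ℤ × ℤ :=
  ∑ j : Fin n, if (j : ℕ) < (i : ℕ) then cubeStep (ω j) else 0

/-- Number of steps in the `±e₁` or `±e₂` directions. -/
def cubeNxy {n : ℕ} (ω : Fin n → Fin 6) : ℕ :=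
  (Finset.univ.filter fun j => ω j = 0 ∨ ω j = 1 ∨ ω j = 2 ∨ ω j = 3).card

/-- Number of steps in the `±e₃` directions. -/
def cubeNz {n : ℕ} (ω : Fin n → Fin 6) : ℕ :=
  (Finset.univ.filter fun j => ω j = 4 ∨ ω j = 5).card

/-- Weight `x^{N₁+N₂} z^{N₃}` of a walk. -/
noncomputable def cubeWeight (x z : ℝ) {n : ℕ} (ω : Fin n → Fin 6) : ℝ :=
  x ^ cubeNxy ω * z ^ cubeNz ω

/-- A walk is self-avoiding if its vertices are pairwise distinct. -/
def cubeIsSAW {n : ℕ} (ω : Fin n → Fin 6) : Prop :=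
  Function.Injective (cubePos ω)

/- `cubeSawCount n x z` is `c_n(x,z)`: the sum of the weights of all `n`-step
self-avoiding walks starting at the origin. -/
open Classical in
noncomputable def cubeSawCount (n : ℕ) (x z : ℝ) : ℝ :=
  ∑ ω ∈ Finset.univ.filter (fun ω : Fin n → Fin 6 => cubeIsSAW ω), cubeWeight x z ω

/-- The weighted connective constant `μ₃(x,z) = inf_{n ≥ 1} c_n(x,z)^{1/n}`. -/
noncomputable def cubeSawMu (x z : ℝ) : ℝ :=
  ⨅ n : ℕ, cubeSawCount (n + 1) x z ^ (1 / (n + 1 : ℝ))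

/-- Weight of a single step. -/
def cubeStepWeight (x z : ℝ) (s : Fin 6) : ℝ :=
  if s = 4 ∨ s = 5 then z else x

/-- The step opposite to a given one. -/
def cubeOpposite : Fin 6 → Fin 6
  | 0 => 1
  | 1 => 0
  | 2 => 3
  | 3 => 2
  | 4 => 5
  | 5 => 4

lemma cubeStep_add_opposite (s : Fin 6) : cubeStep s + cubeStep (cubeOpposite s) = 0 := by
  fin_cases s <;> rfl

lemma cubeStepWeight_pos {x z : ℝ} (hx : 0 < x) (hz : 0 < z) (s : Fin 6) :
    0 < cubeStepWeight x z s := by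
  unfold cubeStepWeight
  split_ifs <;> assumption

lemma cubeWeight_eq_prod (x z : ℝ) {n : ℕ} (ω : Fin n → Fin 6) :
    cubeWeight x z ω = ∏ j, cubeStepWeight x z (ω j) := by
  unfold cubeWeight cubeNxy cubeNz
  rw [← Finset.prod_const, ← Finset.prod_const, Finset.prod_filter, Finset.prod_filter,
    ← Finset.prod_mul_distrib]
  refine Finset.prod_congr rfl fun j _ => ?_
  generalize ω j = s
  fin_cases s <;> simp [cubeStepWeight]

lemma cubePos_succ {n : ℕ} (ω : Fin n → Fin 6) (k : Fin n) :
    cubePos ω k.succ = cubePos ω k.castSucc + cubeStep (ω k) := by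
  have h : cubeStep (ω k) = ∑ j : Fin n, if j = k then cubeStep (ω j) else 0 := by simp
  rw [h]
  unfold cubePos
  rw [← Finset.sum_add_distrib]
  refine Finset.sum_congr rfl fun j _ => ?_
  simp only [Fin.val_succ, Fin.val_castSucc, Fin.ext_iff]
  rcases lt_trichotomy (j : ℕ) k with h | h | h
  · simp [h, h.ne, h.trans (Nat.lt_succ_self _)]
  · simp [h]
  · simp [h.ne', not_lt.mpr h.le, not_lt.mpr (Nat.succ_le_of_lt h)]

/-- A self-avoiding walk never immediately reverses a step. -/
lemma cubeIsSAW.ne_opposite {n : ℕ} {ω : Fin (n + 1) → Fin 6} (h : cubeIsSAW ω) (j : Fin n) :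
    ω j.succ ≠ cubeOpposite (ω j.castSucc) := by
  intro hj
  have h₁ := cubePos_succ ω j.succ
  rw [← Fin.succ_castSucc, cubePos_succ ω j.castSucc, hj, add_assoc, cubeStep_add_opposite,
    add_zero] at h₁
  have h₂ := congrArg Fin.val (h h₁)
  simp only [Fin.val_succ, Fin.val_castSucc] at h₂
  omega

/-- Total weight of the `n`-step continuations, without immediate reversals, of a walk whose last
step is `s`. -/
def cubeNonbacktracking (x z : ℝ) (n : ℕ) (s : Fin 6) : ℝ :=
  ∑ ω : Fin n → Fin 6, ∏ j : Fin n,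
    if ω j = cubeOpposite ((Fin.cons s ω : Fin (n + 1) → Fin 6) j.castSucc) then 0
    else cubeStepWeight x z (ω j)

lemma sum_fin_succ_pi {α : Type*} [Fintype α] {n : ℕ} (f : (Fin (n + 1) → α) → ℝ) :
    ∑ ω, f ω = ∑ s : α, ∑ ω : Fin n → α, f (Fin.cons s ω) := by
  rw [← (Fin.consEquiv fun _ : Fin (n + 1) => α).sum_comp, Fintype.sum_prod_type]
  rfl

lemma cubeNonbacktracking_succ (x z : ℝ) (n : ℕ) (s : Fin 6) :
    cubeNonbacktracking x z (n + 1) s =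
      ∑ t, (if t = cubeOpposite s then 0 else cubeStepWeight x z t) *
        cubeNonbacktracking x z n t := by
  unfold cubeNonbacktracking
  rw [sum_fin_succ_pi]
  refine Finset.sum_congr rfl fun t _ => ?_
  rw [Finset.mul_sum]
  refine Finset.sum_congr rfl fun ω _ => ?_
  rw [Fin.prod_univ_succ]
  simp only [Fin.cons_zero, Fin.cons_succ, Fin.castSucc_zero, ← Fin.succ_castSucc]

lemma cubeNonbacktracking_le {x z : ℝ} (hx : 0 < x) (hz : 0 < z) {r : ℝ} {g : Fin 6 → ℝ}
    (hg : ∀ s, 1 ≤ g s)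
    (hr : ∀ s, ∑ t, (if t = cubeOpposite s then 0 else cubeStepWeight x z t) * g t = r * g s)
    (n : ℕ) (s : Fin 6) : cubeNonbacktracking x z n s ≤ r ^ n * g s := by
  induction n generalizing s with
  | zero => simpa [cubeNonbacktracking] using hg s
  | succ n ih =>
    rw [cubeNonbacktracking_succ]
    calc _ ≤ ∑ t, (if t = cubeOpposite s then 0 else cubeStepWeight x z t) * (r ^ n * g t) := by
          refine Finset.sum_le_sum fun t _ => mul_le_mul_of_nonneg_left (ih t) ?_
          split_ifs
          · exact le_rfl
          · exact (cubeStepWeight_pos hx hz t).le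
      _ = r ^ n * ∑ t, (if t = cubeOpposite s then 0 else cubeStepWeight x z t) * g t := by
          rw [Finset.mul_sum]
          exact Finset.sum_congr rfl fun t _ => by ring
      _ = r ^ (n + 1) * g s := by rw [hr, pow_succ, mul_assoc]

lemma cubeSawCount_succ_le {x z : ℝ} (hx : 0 < x) (hz : 0 < z) (n : ℕ) :
    cubeSawCount (n + 1) x z ≤ ∑ s, cubeStepWeight x z s * cubeNonbacktracking x z n s := by
  classical
  unfold cubeSawCount cubeNonbacktracking
  rw [Finset.sum_filter, sum_fin_succ_pi]
  refine Finset.sum_le_sum fun s _ => ?_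
  rw [Finset.mul_sum]
  refine Finset.sum_le_sum fun ω _ => ?_
  split_ifs with h
  · rw [cubeWeight_eq_prod, Fin.prod_univ_succ]
    simp only [Fin.cons_zero, Fin.cons_succ]
    refine (congrArg _ (Finset.prod_congr rfl fun j _ => ?_)).le
    have hj := h.ne_opposite j
    rw [Fin.cons_succ] at hj
    rw [if_neg hj]
  · refine mul_nonneg (cubeStepWeight_pos hx hz s).le (Finset.prod_nonneg fun j _ => ?_)
    split_ifs
    · exact le_rfl
    · exact (cubeStepWeight_pos hx hz _).le

lemma cubeSawCount_nonneg {x z : ℝ} (hx : 0 < x) (hz : 0 < z) (n : ℕ) :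
    0 ≤ cubeSawCount n x z :=
  Finset.sum_nonneg fun _ _ => by unfold cubeWeight; positivity

open Filter Topology in
/-- An exponential bound on the weighted counts bounds the connective constant. -/
lemma cubeSawMu_le_of_count_le {x z : ℝ} (hx : 0 < x) (hz : 0 < z) {K r : ℝ} (hK : 0 < K)
    (hr : 0 < r) (h : ∀ n, cubeSawCount (n + 1) x z ≤ K * r ^ (n + 1)) :
    cubeSawMu x z ≤ r := by
  have hlim : Tendsto (fun n : ℕ => K ^ (1 / (n + 1 : ℝ)) * r) atTop (𝓝 r) := by
    have := (tendsto_const_nhds (x := K)).rpow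
      (tendsto_one_div_add_atTop_nhds_zero_nat (𝕜 := ℝ)) (Or.inl hK.ne')
    simpa using this.mul_const r
  refine ge_of_tendsto' hlim fun n => ?_
  have hbdd : BddBelow (Set.range fun n : ℕ =>
      cubeSawCount (n + 1) x z ^ (1 / (n + 1 : ℝ))) :=
    ⟨0, by
      rintro _ ⟨n, rfl⟩
      exact Real.rpow_nonneg (cubeSawCount_nonneg hx hz _) _⟩
  refine (ciInf_le hbdd n).trans ?_
  calc cubeSawCount (n + 1) x z ^ (1 / (n + 1 : ℝ))
      ≤ (K * r ^ (n + 1)) ^ (1 / (n + 1 : ℝ)) :=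
        Real.rpow_le_rpow (cubeSawCount_nonneg hx hz _) (h n) (by positivity)
    _ = K ^ (1 / (n + 1 : ℝ)) * r := by
        rw [Real.mul_rpow hK.le (by positivity)]
        congr 1
        have := Real.pow_rpow_inv_natCast hr.le (Nat.succ_ne_zero n)
        simpa using this

theorem cubeSawMu_le_bound_m1_n2 (x z : ℝ) (hx : 0 < x) (hz : 0 < z) :
    cubeSawMu x z ≤ (3 * x + z + Real.sqrt (9 * x ^ 2 + 26 * x * z + z ^ 2)) / 2 := by
  set q := Real.sqrt (9 * x ^ 2 + 26 * x * z + z ^ 2) with hq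
  have hq2 : q ^ 2 = 9 * x ^ 2 + 26 * x * z + z ^ 2 := Real.sq_sqrt (by positivity)
  have hq3 : 3 * x < q := Real.lt_sqrt_of_sq_lt (by nlinarith [mul_pos hx hz, sq_nonneg z])
  set r := (3 * x + z + q) / 2 with hr
  have hr0 : 0 < r := by positivity
  have hb : 0 < r - 3 * x := by linarith
  have hchar : (r - 3 * x) * (r - z) = 8 * x * z := by
    rw [hr]; linear_combination hq2 / 4
  -- Perron eigenvector of the transfer matrix, scaled to have entries at least one
  obtain ⟨g, hgdef⟩ : ∃ g : Fin 6 → ℝ, ∀ s, g s =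
      (if s = 4 ∨ s = 5 then r - 3 * x else 2 * z) * ((2 * z)⁻¹ + (r - 3 * x)⁻¹) :=
    ⟨_, fun _ => rfl⟩
  have hg : ∀ s, 1 ≤ g s := by
    intro s
    rw [hgdef]
    split_ifs
    · rw [mul_add, mul_inv_cancel₀ hb.ne']
      exact le_add_of_nonneg_left (by positivity)
    · rw [mul_add, mul_inv_cancel₀ (by positivity)]
      exact le_add_of_nonneg_right (by positivity)
  have heig : ∀ s,
      ∑ t, (if t = cubeOpposite s then 0 else cubeStepWeight x z t) * g t = r * g s := by
    intro s
    generalize (2 * z)⁻¹ + (r - 3 * x)⁻¹ = c at hgdef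
    fin_cases s <;>
      simp [Fin.sum_univ_six, cubeOpposite, cubeStepWeight, hgdef] <;>
      first
        | ring1
        | linear_combination (-c) * hchar
  have hK : 0 < (∑ s, cubeStepWeight x z s * g s) / r :=
    div_pos (Finset.sum_pos (fun s _ => mul_pos (cubeStepWeight_pos hx hz s)
      (one_pos.trans_le (hg s))) Finset.univ_nonempty) hr0
  refine cubeSawMu_le_of_count_le hx hz hK hr0 fun n => ?_
  refine (cubeSawCount_succ_le hx hz n).trans ?_
  calc _ ≤ ∑ s, cubeStepWeight x z s * (r ^ n * g s) :=
        Finset.sum_le_sum fun s _ => mul_le_mul_of_nonneg_left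
          (cubeNonbacktracking_le hx hz hg heig n s) (cubeStepWeight_pos hx hz s).le
    _ = r ^ n * ∑ s, cubeStepWeight x z s * g s := by
        rw [Finset.mul_sum]
        exact Finset.sum_congr rfl fun s _ => by ring
    _ = _ := by
        rw [pow_succ]
        field_simp
end

section
/- For all weights x, z > 0, the weighted connective constant of self-avoiding trails on the triangular lattice, with steps in the ±(1,0) and ±(0,1) directions weighted x and steps in the ±(1,1) directions weighted z, satisfies μ_T^T(x,z) ≤ 2^{−1/2}·[9x² + 16xz + z² + (3x + z)·√(9x² + 26xz + z²)]^{1/2}. -/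
open scoped BigOperators

def triStep : Fin 6 → ℤ × ℤ
  | 0 => (1, 0)
  | 1 => (-1, 0)
  | 2 => (0, 1)
  | 3 => (0, -1)
  | 4 => (1, 1)
  | 5 => (-1, -1)

/-- Position of the walk after `i` steps, starting at the origin. -/
def triPos {n : ℕ} (ω : Fin n → Fin 6) (i : Fin (n + 1)) : ℤ × ℤ :=
  ∑ j : Fin n, if (j : ℕ) < (i : ℕ) then triStep (ω j) else 0

/-- Number of steps in the `±(1,0)` or `±(0,1)` directions. -/
def triNa {n : ℕ} (ω : Fin n → Fin 6) : ℕ :=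
  (Finset.univ.filter fun j => ω j = 0 ∨ ω j = 1 ∨ ω j = 2 ∨ ω j = 3).card

/-- Number of steps in the `±(1,1)` directions. -/
def triNd {n : ℕ} (ω : Fin n → Fin 6) : ℕ :=
  (Finset.univ.filter fun j => ω j = 4 ∨ ω j = 5).card

/-- Weight `x^{N_a} z^{N_d}` of a walk. -/
noncomputable def triWeight (x z : ℝ) {n : ℕ} (ω : Fin n → Fin 6) : ℝ :=
  x ^ triNa ω * z ^ triNd ω

/-- A walk is a self-avoiding trail if its undirected edges are pairwise distinct. -/
def triIsSAT {n : ℕ} (ω : Fin n → Fin 6) : Prop :=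
  Function.Injective (fun i : Fin n => s(triPos ω i.castSucc, triPos ω i.succ))

/- `triSatCount n x z` is `c^T_n(x,z)`: the sum of the weights of all `n`-step
self-avoiding trails starting at the origin. -/
open Classical in
noncomputable def triSatCount (n : ℕ) (x z : ℝ) : ℝ :=
  ∑ ω ∈ Finset.univ.filter (fun ω : Fin n → Fin 6 => triIsSAT ω), triWeight x z ω

/-- The weighted connective constant `μ_T^T(x,z) = inf_{n ≥ 1} c^T_n(x,z)^{1/n}`. -/
noncomputable def triSatMu (x z : ℝ) : ℝ :=
  ⨅ n : ℕ, triSatCount (n + 1) x z ^ (1 / (n + 1 : ℝ))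

lemma Fintype.sum_fin_succ_arrow {α M : Type*} [Fintype α] [AddCommMonoid M] {n : ℕ}
    (f : (Fin (n + 1) → α) → M) :
    ∑ ω, f ω = ∑ t, ∑ ω : Fin n → α, f (Fin.cons t ω : Fin (n + 1) → α) := by
  rw [← (Fin.consEquiv fun _ : Fin (n + 1) => α).sum_comp, Fintype.sum_prod_type]
  rfl

/-- The direction opposite to a given one. -/
def triRev : Fin 6 → Fin 6 := ![1, 0, 3, 2, 5, 4]

lemma triStep_triRev (s : Fin 6) : triStep (triRev s) = -triStep s := by
  fin_cases s <;> rfl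

/-- The weight of a single step. -/
def triStepWeight (x z : ℝ) : Fin 6 → ℝ := ![x, x, x, x, z, z]

lemma triStepWeight_nonneg {x z : ℝ} (hx : 0 ≤ x) (hz : 0 ≤ z) (s : Fin 6) :
    0 ≤ triStepWeight x z s := by
  fin_cases s <;> simpa [triStepWeight]

lemma triWeight_eq_prod (x z : ℝ) {n : ℕ} (ω : Fin n → Fin 6) :
    triWeight x z ω = ∏ j, triStepWeight x z (ω j) := by
  have h : ∀ s : Fin 6, triStepWeight x z s =
      (if s = 0 ∨ s = 1 ∨ s = 2 ∨ s = 3 then x else 1) * (if s = 4 ∨ s = 5 then z else 1) := by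
    intro s
    fin_cases s <;> simp [triStepWeight]
  simp only [h, Finset.prod_mul_distrib, triWeight, triNa, triNd, Finset.prod_ite,
    Finset.prod_const, one_pow, mul_one]

lemma triPos_succ {n : ℕ} (ω : Fin n → Fin 6) (i : Fin n) :
    triPos ω i.succ = triPos ω i.castSucc + triStep (ω i) := by
  have h : triStep (ω i) = ∑ j : Fin n, if j = i then triStep (ω j) else 0 := by simp
  rw [h, triPos, triPos, ← Finset.sum_add_distrib]
  refine Finset.sum_congr rfl fun j _ => ?_
  simp only [Fin.val_succ, Fin.val_castSucc, Fin.ext_iff]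
  rcases lt_trichotomy (j : ℕ) i with h | h | h
  · simp [h, h.ne, h.trans (Nat.lt_succ_self _)]
  · simp [h]
  · simp [h.ne', h.not_gt, show ¬ (j : ℕ) < i + 1 by omega]

/-- A walk without immediate reversals. -/
def triIsNonbacktracking {n : ℕ} (ω : Fin (n + 1) → Fin 6) : Prop :=
  ∀ i : Fin n, ω i.succ ≠ triRev (ω i.castSucc)

lemma triIsSAT.isNonbacktracking {n : ℕ} {ω : Fin (n + 1) → Fin 6} (h : triIsSAT ω) :
    triIsNonbacktracking ω := by
  intro i hi
  have key : triPos ω i.succ.succ = triPos ω i.castSucc.castSucc := by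
    rw [triPos_succ, hi, triStep_triRev, ← Fin.succ_castSucc, triPos_succ]
    abel
  have he : i.castSucc = i.succ := h <| by
    change s(triPos ω i.castSucc.castSucc, triPos ω i.castSucc.succ) =
      s(triPos ω i.succ.castSucc, triPos ω i.succ.succ)
    rw [key, ← Fin.succ_castSucc, Sym2.eq_swap]
  simp [Fin.ext_iff] at he

lemma triIsNonbacktracking_cons {n : ℕ} (s : Fin 6) (ω : Fin (n + 1) → Fin 6) :
    triIsNonbacktracking (Fin.cons s ω : Fin (n + 2) → Fin 6) ↔
      ω 0 ≠ triRev s ∧ triIsNonbacktracking ω := by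
  simp only [triIsNonbacktracking, Fin.forall_fin_succ (n := n)]
  rfl

open Classical in
/-- The weighted number of ways of continuing a step in direction `s` by `n` further steps
without immediate reversals. -/
noncomputable def triExtensionCount (x z : ℝ) (n : ℕ) (s : Fin 6) : ℝ :=
  ∑ ω : Fin n → Fin 6, if triIsNonbacktracking (Fin.cons s ω : Fin (n + 1) → Fin 6)
    then ∏ j, triStepWeight x z (ω j) else 0

lemma triExtensionCount_zero (x z : ℝ) (s : Fin 6) : triExtensionCount x z 0 s = 1 := by
  simp [triExtensionCount, triIsNonbacktracking]

lemma triExtensionCount_succ (x z : ℝ) (n : ℕ) (s : Fin 6) :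
    triExtensionCount x z (n + 1) s =
      ∑ t, if t ≠ triRev s then triStepWeight x z t * triExtensionCount x z n t else 0 := by
  classical
  rw [triExtensionCount, Fintype.sum_fin_succ_arrow]
  refine Finset.sum_congr rfl fun t _ => ?_
  have key (ω : Fin n → Fin 6) :
      triIsNonbacktracking (Fin.cons s (Fin.cons t ω : Fin (n + 1) → Fin 6) :
        Fin (n + 1 + 1) → Fin 6) ↔
      t ≠ triRev s ∧ triIsNonbacktracking (Fin.cons t ω : Fin (n + 1) → Fin 6) :=
    triIsNonbacktracking_cons s _
  by_cases h : t = triRev s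
  · rw [if_neg (not_not.2 h)]
    exact Finset.sum_eq_zero fun ω _ => if_neg fun hn => ((key ω).1 hn).1 h
  · rw [if_pos h, triExtensionCount, Finset.mul_sum]
    refine Finset.sum_congr rfl fun ω _ => ?_
    rw [mul_ite, mul_zero]
    exact if_congr ((key ω).trans (and_iff_right h)) (by simp [Fin.prod_univ_succ]) rfl

lemma triSatCount_succ_le {x z : ℝ} (hx : 0 ≤ x) (hz : 0 ≤ z) (n : ℕ) :
    triSatCount (n + 1) x z ≤ ∑ s, triStepWeight x z s * triExtensionCount x z n s := by
  classical
  rw [triSatCount, Finset.sum_filter, Fintype.sum_fin_succ_arrow]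
  refine Finset.sum_le_sum fun t _ => ?_
  rw [triExtensionCount, Finset.mul_sum]
  refine Finset.sum_le_sum fun ω _ => ?_
  simp only [triWeight_eq_prod, Fin.prod_univ_succ, Fin.cons_zero,
    Fin.cons_succ]
  have hw := triStepWeight_nonneg hx hz
  have hp : 0 ≤ ∏ j, triStepWeight x z (ω j) := Finset.prod_nonneg fun j _ => hw _
  by_cases h : triIsSAT (Fin.cons t ω : Fin (n + 1) → Fin 6)
  · rw [if_pos h, if_pos h.isNonbacktracking]
  · rw [if_neg h]
    exact mul_nonneg (hw t) (by split_ifs <;> [exact hp; exact le_rfl])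

lemma triSatCount_nonneg {x z : ℝ} (hx : 0 ≤ x) (hz : 0 ≤ z) (n : ℕ) :
    0 ≤ triSatCount n x z :=
  Finset.sum_nonneg fun _ _ => mul_nonneg (pow_nonneg hx _) (pow_nonneg hz _)

/-- A vector `(a, d)` with `a, d > 0` that is an eigenvector, for the eigenvalue `r`, of the
transfer matrix of nonbacktracking walks bounds the number of extensions. -/
lemma exists_triExtensionCount_le {x z r a d : ℝ} (hx : 0 ≤ x) (hz : 0 ≤ z) (ha : 0 < a)
    (hd : 0 < d) (hA : 3 * x * a + 2 * z * d = r * a) (hD : 4 * x * a + z * d = r * d) :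
    ∃ C : ℝ, ∀ n s, triExtensionCount x z n s ≤ C * r ^ n := by
  obtain ⟨h, hh⟩ : ∃ h : Fin 6 → ℝ, h = ![a, a, a, a, d, d] := ⟨_, rfl⟩
  have hr : 0 ≤ r := by
    have : 0 ≤ r * a := hA ▸ by positivity
    exact nonneg_of_mul_nonneg_left this ha
  have hstep : ∀ s, (∑ t, if t ≠ triRev s then triStepWeight x z t * h t else 0) = r * h s := by
    intro s
    fin_cases s <;> simp [hh, Fin.sum_univ_six, triRev, triStepWeight] <;> linarith
  have hm : 0 < min a d := lt_min ha hd
  have hlow : ∀ s, min a d ≤ h s := by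
    intro s
    fin_cases s <;> simp [hh]
  have hup : ∀ s, h s ≤ max a d := by
    intro s
    fin_cases s <;> simp [hh]
  have key : ∀ n s, triExtensionCount x z n s ≤ (min a d)⁻¹ * r ^ n * h s := by
    intro n
    induction n with
    | zero =>
      intro s
      rw [triExtensionCount_zero, pow_zero, mul_one, ← div_eq_inv_mul, one_le_div hm]
      exact hlow s
    | succ n ih =>
      intro s
      rw [triExtensionCount_succ, pow_succ,
        show (min a d)⁻¹ * (r ^ n * r) * h s = (min a d)⁻¹ * r ^ n * (r * h s) by ring,
        ← hstep, Finset.mul_sum]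
      refine Finset.sum_le_sum fun t _ => ?_
      split_ifs
      · calc triStepWeight x z t * triExtensionCount x z n t
            ≤ triStepWeight x z t * ((min a d)⁻¹ * r ^ n * h t) :=
              mul_le_mul_of_nonneg_left (ih t) (triStepWeight_nonneg hx hz t)
          _ = _ := by ring
      · simp
  refine ⟨(min a d)⁻¹ * max a d, fun n s => (key n s).trans ?_⟩
  calc (min a d)⁻¹ * r ^ n * h s ≤ (min a d)⁻¹ * r ^ n * max a d :=
        mul_le_mul_of_nonneg_left (hup s) (by positivity)
    _ = _ := by ring

lemma triSatMu_le_of_triSatCount_le {x z r C : ℝ} (hx : 0 ≤ x) (hz : 0 ≤ z) (hr : 0 < r)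
    (h : ∀ n, triSatCount (n + 1) x z ≤ C * r ^ (n + 1)) : triSatMu x z ≤ r := by
  by_contra! hlt
  obtain ⟨n, hn⟩ := pow_unbounded_of_one_lt C ((one_lt_div hr).2 hlt)
  have hc := triSatCount_nonneg hx hz (n + 1)
  have hle : triSatMu x z ≤ triSatCount (n + 1) x z ^ (1 / (n + 1 : ℝ)) :=
    ciInf_le ⟨0, by
      rintro _ ⟨k, rfl⟩
      exact Real.rpow_nonneg (triSatCount_nonneg hx hz _) _⟩ n
  have hpow : triSatMu x z ^ (n + 1) ≤ C * r ^ (n + 1) := by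
    refine (pow_le_pow_left₀ (hr.trans hlt).le hle _).trans (le_of_eq_of_le ?_ (h n))
    rw [← Real.rpow_natCast, ← Real.rpow_mul hc]
    push_cast
    rw [one_div_mul_cancel (by positivity), Real.rpow_one]
  have hdiv : (triSatMu x z / r) ^ (n + 1) ≤ C := by
    rwa [div_pow, div_le_iff₀ (by positivity)]
  have := pow_le_pow_right₀ ((one_lt_div hr).2 hlt).le n.le_succ
  exact absurd (hn.trans_le (this.trans hdiv)) (lt_irrefl _)

theorem triSatMu_le_bound_m1_n3 (x z : ℝ) (hx : 0 < x) (hz : 0 < z) :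
    triSatMu x z ≤ (2 : ℝ) ^ (-(1 / 2 : ℝ)) *
      (9 * x ^ 2 + 16 * x * z + z ^ 2 +
        (3 * x + z) * Real.sqrt (9 * x ^ 2 + 26 * x * z + z ^ 2)) ^ (1 / 2 : ℝ) := by
  set q := Real.sqrt (9 * x ^ 2 + 26 * x * z + z ^ 2) with hq
  have hxz : 0 < x * z := mul_pos hx hz
  have hq2 : q ^ 2 = 9 * x ^ 2 + 26 * x * z + z ^ 2 := Real.sq_sqrt (by positivity)
  have hq0 : 0 ≤ q := Real.sqrt_nonneg _
  have hq3 : 3 * x - z < q := by nlinarith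
  set r := (3 * x + z + q) / 2 with hr
  have hr0 : 0 < r := by positivity
  have hrhs : (2 : ℝ) ^ (-(1 / 2 : ℝ)) *
      (9 * x ^ 2 + 16 * x * z + z ^ 2 + (3 * x + z) * q) ^ (1 / 2 : ℝ) = r := by
    have : 9 * x ^ 2 + 16 * x * z + z ^ 2 + (3 * x + z) * q = 2 * r ^ 2 := by
      rw [hr]; linarith
    rw [this, Real.mul_rpow zero_le_two (by positivity), ← mul_assoc,
      ← Real.rpow_add zero_lt_two, neg_add_cancel, Real.rpow_zero, one_mul,
      ← Real.sqrt_eq_rpow, Real.sqrt_sq hr0.le]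
  rw [hrhs]
  obtain ⟨C, hC⟩ := exists_triExtensionCount_le (r := r) (a := 2 * z) (d := r - 3 * x) hx.le hz.le
    (by positivity) (by linarith) (by ring) (by rw [hr]; linarith)
  have hw := triStepWeight_nonneg hx.le hz.le
  refine triSatMu_le_of_triSatCount_le (C := (∑ s, triStepWeight x z s) * C / r) hx.le hz.le hr0
    fun n => (triSatCount_succ_le hx.le hz.le n).trans ?_
  calc ∑ s, triStepWeight x z s * triExtensionCount x z n s
      ≤ ∑ s, triStepWeight x z s * (C * r ^ n) :=
        Finset.sum_le_sum fun s _ => mul_le_mul_of_nonneg_left (hC n s) (hw s)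
    _ = (∑ s, triStepWeight x z s) * C / r * r ^ (n + 1) := by
        rw [← Finset.sum_mul]
        field_simp
        ring
end

section
/- For all weights x, z > 0, the weighted connective constant of self-avoiding walks on the hexagonal lattice, with edges in the (1,0) and (0,1) directions weighted x and edges in the (1,1) direction weighted z, satisfies μ_H(x,z) ≤ (1/2)·(x + √(x·(x + 8z))). -/
open scoped BigOperators

/-- Steps available from a class-A vertex of the hexagonal lattice. -/
def hexStepA : Fin 3 → ℤ × ℤ
  | 0 => (1, 0)
  | 1 => (0, 1)
  | 2 => (-1, -1)

/-- Steps available from a class-B vertex of the hexagonal lattice. -/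
def hexStepB : Fin 3 → ℤ × ℤ
  | 0 => (-1, 0)
  | 1 => (0, -1)
  | 2 => (1, 1)

/-- Position after `i` steps of a walk starting at the class-A vertex `(0,0)`:
the vertex classes alternate along the walk, starting with class A. -/
def hexPosA {n : ℕ} (ω : Fin n → Fin 3) (i : Fin (n + 1)) : ℤ × ℤ :=
  ∑ j : Fin n, if (j : ℕ) < (i : ℕ) then
    (if (j : ℕ) % 2 = 0 then hexStepA (ω j) else hexStepB (ω j)) else 0

/-- Position after `i` steps of a walk starting at the class-B vertex `(1,0)`:
the vertex classes alternate along the walk, starting with class B. -/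
def hexPosB {n : ℕ} (ω : Fin n → Fin 3) (i : Fin (n + 1)) : ℤ × ℤ :=
  (1, 0) + ∑ j : Fin n, if (j : ℕ) < (i : ℕ) then
    (if (j : ℕ) % 2 = 0 then hexStepB (ω j) else hexStepA (ω j)) else 0

/-- Number of edges in the `±(1,0)` or `±(0,1)` directions. -/
def hexNa {n : ℕ} (ω : Fin n → Fin 3) : ℕ :=
  (Finset.univ.filter fun j => ω j = 0 ∨ ω j = 1).card

/-- Number of edges in the `±(1,1)` directions. -/
def hexNd {n : ℕ} (ω : Fin n → Fin 3) : ℕ :=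
  (Finset.univ.filter fun j => ω j = 2).card

/-- Weight `x^{N_a} z^{N_d}` of a walk. -/
noncomputable def hexWeight (x z : ℝ) {n : ℕ} (ω : Fin n → Fin 3) : ℝ :=
  x ^ hexNa ω * z ^ hexNd ω

/- `hexSawCountA n x z` is `c_{n,A}(x,z)`: the sum of the weights of all `n`-step
self-avoiding walks starting at the class-A vertex `(0,0)`. -/
open Classical in
noncomputable def hexSawCountA (n : ℕ) (x z : ℝ) : ℝ :=
  ∑ ω ∈ Finset.univ.filter (fun ω : Fin n → Fin 3 => Function.Injective (hexPosA ω)),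
    hexWeight x z ω

/- `hexSawCountB n x z` is `c_{n,B}(x,z)`: the sum of the weights of all `n`-step
self-avoiding walks starting at the class-B vertex `(1,0)`. -/
open Classical in
noncomputable def hexSawCountB (n : ℕ) (x z : ℝ) : ℝ :=
  ∑ ω ∈ Finset.univ.filter (fun ω : Fin n → Fin 3 => Function.Injective (hexPosB ω)),
    hexWeight x z ω

/-- `c_n(x,z) := max(c_{n,A}(x,z), c_{n,B}(x,z))`. -/
noncomputable def hexSawCount (n : ℕ) (x z : ℝ) : ℝ :=
  max (hexSawCountA n x z) (hexSawCountB n x z)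

/-- The weighted connective constant `μ_H(x,z) = inf_{n ≥ 1} c_n(x,z)^{1/n}`. -/
noncomputable def hexSawMu (x z : ℝ) : ℝ :=
  ⨅ n : ℕ, hexSawCount (n + 1) x z ^ (1 / (n + 1 : ℝ))

open Finset in
theorem partialSum_add_two_eq_of_cancel {M : Type*} [AddCommMonoid M] {n : ℕ}
    (f : Fin (n + 1) → M) (i : Fin n) (h : f i.castSucc + f i.succ = 0) :
    (∑ j : Fin (n + 1), if (j : ℕ) < (i : ℕ) + 2 then f j else 0) =
      ∑ j : Fin (n + 1), if (j : ℕ) < (i : ℕ) then f j else 0 := by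
  have split (j : Fin (n + 1)) : (if (j : ℕ) < (i : ℕ) + 2 then f j else 0) =
      (if (j : ℕ) < (i : ℕ) then f j else 0) +
        ((if j = i.castSucc then f j else 0) + (if j = i.succ then f j else 0)) := by
    simp only [Fin.ext_iff, Fin.val_castSucc, Fin.val_succ]
    split_ifs <;> first | omega | simp
  simp only [split, sum_add_distrib, sum_ite_eq', mem_univ, if_true, h, add_zero]

theorem hexStepA_add_hexStepB (s : Fin 3) : hexStepA s + hexStepB s = 0 := by
  fin_cases s <;> rfl

/-- Consecutive steps of a walk differ. -/
def HexNonBacktracking {n : ℕ} (ω : Fin (n + 1) → Fin 3) : Prop :=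
  ∀ i : Fin n, ω i.castSucc ≠ ω i.succ

theorem HexNonBacktracking.of_injective_hexPosA {n : ℕ} {ω : Fin (n + 1) → Fin 3}
    (h : Function.Injective (hexPosA ω)) : HexNonBacktracking ω := by
  intro i hi
  have key : hexPosA ω ⟨i + 2, by omega⟩ = hexPosA ω ⟨i, by omega⟩ := by
    apply partialSum_add_two_eq_of_cancel
    rcases Nat.mod_two_eq_zero_or_one i with h0 | h0
    · have h1 : ((i : ℕ) + 1) % 2 = 1 := by omega
      simp [h0, h1, hi, hexStepA_add_hexStepB]
    · have h1 : ((i : ℕ) + 1) % 2 = 0 := by omega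
      simp [h0, h1, hi, add_comm (hexStepB _), hexStepA_add_hexStepB]
  simpa using h key

theorem HexNonBacktracking.of_injective_hexPosB {n : ℕ} {ω : Fin (n + 1) → Fin 3}
    (h : Function.Injective (hexPosB ω)) : HexNonBacktracking ω := by
  intro i hi
  have key : hexPosB ω ⟨i + 2, by omega⟩ = hexPosB ω ⟨i, by omega⟩ := by
    apply congrArg ((1, 0) + ·)
    apply partialSum_add_two_eq_of_cancel
    rcases Nat.mod_two_eq_zero_or_one i with h0 | h0
    · have h1 : ((i : ℕ) + 1) % 2 = 1 := by omega
      simp [h0, h1, hi, add_comm (hexStepB _), hexStepA_add_hexStepB]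
    · have h1 : ((i : ℕ) + 1) % 2 = 0 := by omega
      simp [h0, h1, hi, hexStepA_add_hexStepB]
  simpa using h key

theorem hexNonBacktracking_cons_cons {n : ℕ} (t s : Fin 3) (ω : Fin n → Fin 3) :
    HexNonBacktracking (Fin.cons t (Fin.cons s ω : Fin (n + 1) → Fin 3) : Fin (n + 2) → Fin 3) ↔
      t ≠ s ∧ HexNonBacktracking (Fin.cons s ω : Fin (n + 1) → Fin 3) := by
  simp [HexNonBacktracking, Fin.forall_fin_succ (n := n)]

theorem hexWeight_eq_prod (x z : ℝ) {n : ℕ} (ω : Fin n → Fin 3) :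
    hexWeight x z ω = ∏ j, ![x, x, z] (ω j) := by
  have split (s : Fin 3) :
      ![x, x, z] s = (if s = 0 ∨ s = 1 then x else 1) * (if s = 2 then z else 1) := by
    fin_cases s <;> simp
  simp only [hexWeight, hexNa, hexNd, split, Finset.prod_mul_distrib]
  simp [Finset.prod_ite]

theorem hexWeight_cons (x z : ℝ) {n : ℕ} (s : Fin 3) (ω : Fin n → Fin 3) :
    hexWeight x z (Fin.cons s ω : Fin (n + 1) → Fin 3) = ![x, x, z] s * hexWeight x z ω := by
  simp [hexWeight_eq_prod, Fin.prod_univ_succ]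

theorem hexWeight_nonneg {x z : ℝ} (hx : 0 ≤ x) (hz : 0 ≤ z) {n : ℕ} (ω : Fin n → Fin 3) :
    0 ≤ hexWeight x z ω :=
  mul_nonneg (pow_nonneg hx _) (pow_nonneg hz _)

theorem Fin.sum_cons_eq {α M : Type*} [Fintype α] [AddCommMonoid M] {n : ℕ}
    (f : (Fin (n + 1) → α) → M) :
    ∑ ω, f ω = ∑ s, ∑ ω : Fin n → α, f (Fin.cons s ω) := by
  rw [← (Fin.consEquiv fun _ : Fin (n + 1) => α).sum_comp, Fintype.sum_prod_type]
  rfl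

open Classical in
/-- Total weight of the non-backtracking continuations by `n` steps of a walk whose last step
has label `t`. -/
noncomputable def hexContinuation (n : ℕ) (x z : ℝ) (t : Fin 3) : ℝ :=
  ∑ ω : Fin n → Fin 3,
    if HexNonBacktracking (Fin.cons t ω : Fin (n + 1) → Fin 3) then hexWeight x z ω else 0

theorem hexContinuation_succ (n : ℕ) (x z : ℝ) (t : Fin 3) :
    hexContinuation (n + 1) x z t =
      ∑ s, if t ≠ s then ![x, x, z] s * hexContinuation n x z s else 0 := by
  classical
  rw [hexContinuation, Fin.sum_cons_eq]
  refine Finset.sum_congr rfl fun s _ => ?_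
  simp only [hexNonBacktracking_cons_cons, hexWeight_cons, hexContinuation, Finset.mul_sum]
  split_ifs with h <;> simp [h]

/-- The vector `(l, l, 2x)` is an eigenvector of the non-backtracking transfer matrix for the
eigenvalue `l`. -/
theorem min_mul_hexContinuation_le {x z l : ℝ} (hx : 0 < x) (hz : 0 < z)
    (hl : l ^ 2 = x * l + 2 * x * z) (n : ℕ) (t : Fin 3) :
    min l (2 * x) * hexContinuation n x z t ≤ l ^ n * ![l, l, 2 * x] t := by
  induction n generalizing t with
  | zero => fin_cases t <;> simp [hexContinuation, HexNonBacktracking, hexWeight, hexNa, hexNd]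
  | succ n ih =>
    have h0 := mul_le_mul_of_nonneg_left (ih 0) hx.le
    have h1 := mul_le_mul_of_nonneg_left (ih 1) hx.le
    have h2 := mul_le_mul_of_nonneg_left (ih 2) hz.le
    have hl' : l ^ n * l ^ 2 = l ^ n * (x * l + 2 * x * z) := by rw [hl]
    rw [hexContinuation_succ]
    fin_cases t <;> simp [Fin.sum_univ_three] at h0 h1 h2 ⊢ <;> rw [pow_succ] <;> linarith

theorem sum_hexWeight_le {x z l : ℝ} (hx : 0 < x) (hz : 0 < z) (hl₀ : 0 < l)
    (hl : l ^ 2 = x * l + 2 * x * z) (n : ℕ) (S : Finset (Fin (n + 1) → Fin 3))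
    (hS : ∀ ω ∈ S, HexNonBacktracking ω) :
    ∑ ω ∈ S, hexWeight x z ω ≤ 2 * (x + z) / min l (2 * x) * l ^ (n + 1) := by
  classical
  have hm : 0 < min l (2 * x) := by positivity
  have hle : ∑ ω ∈ S, hexWeight x z ω ≤ ∑ t, ![x, x, z] t * hexContinuation n x z t := by
    calc
      ∑ ω ∈ S, hexWeight x z ω
          ≤ ∑ ω ∈ Finset.univ.filter (HexNonBacktracking (n := n)), hexWeight x z ω :=
        Finset.sum_le_sum_of_subset_of_nonneg (fun ω hω => by simpa using hS ω hω)
          fun ω _ _ => hexWeight_nonneg hx.le hz.le ω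
      _ = ∑ t, ![x, x, z] t * hexContinuation n x z t := by
        rw [Finset.sum_filter, Fin.sum_cons_eq]
        simp only [hexWeight_cons, hexContinuation, Finset.mul_sum, mul_ite, mul_zero]
  rw [div_mul_eq_mul_div, le_div_iff₀' hm]
  refine (mul_le_mul_of_nonneg_left hle hm.le).trans ?_
  have h0 := mul_le_mul_of_nonneg_left (min_mul_hexContinuation_le hx hz hl n 0) hx.le
  have h1 := mul_le_mul_of_nonneg_left (min_mul_hexContinuation_le hx hz hl n 1) hx.le
  have h2 := mul_le_mul_of_nonneg_left (min_mul_hexContinuation_le hx hz hl n 2) hz.le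
  have hxl : x ≤ l := by nlinarith [mul_pos hx hz]
  have h3 : l ^ n * (z * x) ≤ l ^ n * (z * l) := by gcongr
  simp [Fin.sum_univ_three] at h0 h1 h2 ⊢
  rw [pow_succ]
  linarith

theorem hexSawCount_succ_le {x z l : ℝ} (hx : 0 < x) (hz : 0 < z) (hl₀ : 0 < l)
    (hl : l ^ 2 = x * l + 2 * x * z) (n : ℕ) :
    hexSawCount (n + 1) x z ≤ 2 * (x + z) / min l (2 * x) * l ^ (n + 1) := by
  refine max_le (sum_hexWeight_le hx hz hl₀ hl n _ fun ω hω => ?_)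
    (sum_hexWeight_le hx hz hl₀ hl n _ fun ω hω => ?_)
  · exact .of_injective_hexPosA (Finset.mem_filter.mp hω).2
  · exact .of_injective_hexPosB (Finset.mem_filter.mp hω).2

theorem hexSawCount_nonneg {x z : ℝ} (hx : 0 ≤ x) (hz : 0 ≤ z) (n : ℕ) : 0 ≤ hexSawCount n x z :=
  le_max_of_le_left (Finset.sum_nonneg fun ω _ => hexWeight_nonneg hx hz ω)

/-- An exponential upper bound on a nonnegative sequence bounds the infimum of its roots. -/
theorem Real.iInf_rpow_one_div_le_of_le_mul_pow {c : ℕ → ℝ} {C l : ℝ} (hc : ∀ n, 0 ≤ c (n + 1))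
    (hC : 0 < C) (hl : 0 ≤ l) (h : ∀ n, c (n + 1) ≤ C * l ^ (n + 1)) :
    ⨅ n : ℕ, c (n + 1) ^ (1 / (n + 1 : ℝ)) ≤ l := by
  have lim : Filter.Tendsto (fun n : ℕ => C ^ (1 / (n + 1 : ℝ)) * l) Filter.atTop (nhds l) := by
    have := (Filter.Tendsto.rpow tendsto_const_nhds
      (tendsto_one_div_add_atTop_nhds_zero_nat (𝕜 := ℝ)) (.inl hC.ne'))
    simpa using this.mul_const l
  refine ge_of_tendsto' lim fun n => ?_
  refine (ciInf_le ⟨0, ?_⟩ n).trans ?_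
  · rintro _ ⟨k, rfl⟩
    exact Real.rpow_nonneg (hc k) _
  · calc
      c (n + 1) ^ (1 / (n + 1 : ℝ)) ≤ (C * l ^ (n + 1)) ^ (1 / (n + 1 : ℝ)) :=
        Real.rpow_le_rpow (hc n) (h n) (by positivity)
      _ = C ^ (1 / (n + 1 : ℝ)) * l := by
        rw [Real.mul_rpow hC.le (by positivity)]
        congr 1
        simpa using Real.pow_rpow_inv_natCast hl n.succ_ne_zero

theorem hexSawMu_le_bound_m1_n2 (x z : ℝ) (hx : 0 < x) (hz : 0 < z) :
    hexSawMu x z ≤ (x + Real.sqrt (x * (x + 8 * z))) / 2 := by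
  have hsq : Real.sqrt (x * (x + 8 * z)) ^ 2 = x * (x + 8 * z) := Real.sq_sqrt (by positivity)
  have hl₀ : 0 < (x + Real.sqrt (x * (x + 8 * z))) / 2 := by positivity
  refine Real.iInf_rpow_one_div_le_of_le_mul_pow (c := fun n => hexSawCount n x z)
    (fun n => hexSawCount_nonneg hx.le hz.le _) (C := 2 * (x + z) / min _ (2 * x)) (by positivity)
    hl₀.le (hexSawCount_succ_le hx hz hl₀ ?_)
  linear_combination hsq / 4
end
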